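/- arXiv:1006.4290 — 9 statements merged into one kernel-verified Lean document; each statement's English description precedes it below -/
import Mathlib

section
/- Let R be a commutative ring. For every pair of polynomials f, g ∈ R[X] there exists a natural number n ≥ 1 such that c(f)^n · c(g) = c(f)^(n-1) · c(f·g). -/
/-- The content of a polynomial `f ∈ R[X]`: the ideal of `R` generated by its
coefficients. -/
def polyContent {R : Type*} [CommRing R] (f : Polynomial R) : Ideal R :=
  Ideal.span (Set.range f.coeff)

open Polynomial

section

variable {R : Type*} [CommRing R]

theorem coeff_mem_polyContent (f : R[X]) (n : ℕ) : f.coeff n ∈ polyContent f :=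
  Ideal.subset_span ⟨n, rfl⟩

theorem polyContent_mul_le (f g : R[X]) :
    polyContent (f * g) ≤ polyContent f * polyContent g := by
  refine Ideal.span_le.2 ?_
  rintro _ ⟨n, rfl⟩
  rw [SetLike.mem_coe, coeff_mul]
  exact sum_mem fun p _ ↦
    Ideal.mul_mem_mul (coeff_mem_polyContent f p.1) (coeff_mem_polyContent g p.2)

/-- The ideal generated by the coefficients of `f` of index less than `i`. -/
def lowerContent (f : R[X]) (i : ℕ) : Ideal R :=
  Ideal.span (f.coeff '' Set.Iio i)

theorem coeff_mem_lowerContent (f : R[X]) {p i : ℕ} (h : p < i) :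
    f.coeff p ∈ lowerContent f i :=
  Ideal.subset_span ⟨p, h, rfl⟩

theorem lowerContent_zero (f : R[X]) : lowerContent f 0 = ⊥ := by
  simp [lowerContent]

theorem lowerContent_succ (f : R[X]) (i : ℕ) :
    lowerContent f (i + 1) = lowerContent f i ⊔ Ideal.span {f.coeff i} := by
  have h : Set.Iio (i + 1) = Set.Iio i ∪ {i} := by
    ext p
    simp
  rw [lowerContent, h, Set.image_union, Set.image_singleton, Ideal.span_union, lowerContent]

theorem lowerContent_le_polyContent (f : R[X]) (i : ℕ) : lowerContent f i ≤ polyContent f :=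
  Ideal.span_mono (Set.image_subset_range _ _)

theorem polyContent_le_lowerContent (f : R[X]) :
    polyContent f ≤ lowerContent f (f.natDegree + 1) := by
  refine Ideal.span_le.2 ?_
  rintro _ ⟨n, rfl⟩
  by_cases h : n < f.natDegree + 1
  · exact coeff_mem_lowerContent f h
  · rw [coeff_eq_zero_of_natDegree_lt (by omega)]
    exact zero_mem _

theorem sup_pow_succ_le (J L : Ideal R) (k : ℕ) :
    (J ⊔ L) ^ (k + 1) ≤ L ^ (k + 1) ⊔ J * (J ⊔ L) ^ k := by
  induction k with
  | zero => simp [sup_comm]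
  | succ k ih =>
    calc (J ⊔ L) ^ (k + 1 + 1) = J * (J ⊔ L) ^ (k + 1) ⊔ L * (J ⊔ L) ^ (k + 1) := by
          rw [pow_succ' _ (k + 1), Ideal.sup_mul]
      _ ≤ J * (J ⊔ L) ^ (k + 1) ⊔ L * (L ^ (k + 1) ⊔ J * (J ⊔ L) ^ k) := by gcongr
      _ ≤ L ^ (k + 1 + 1) ⊔ J * (J ⊔ L) ^ (k + 1) := by
          rw [Ideal.mul_sup, ← pow_succ', mul_left_comm L J]
          refine sup_le le_sup_right (sup_le le_sup_left (le_sup_of_le_right ?_))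
          rw [pow_succ' (J ⊔ L) k]
          gcongr
          exact le_sup_right

/-- If `S` sends `B` into `C` modulo `J` after finitely many steps, and `J` sends `B` into `C`
after finitely many steps, then so does `S`, all degrees being counted in powers of `A`. -/
theorem mul_pow_mul_le_of_pow_mul_le_sup {A B C J S : Ideal R} {N k : ℕ} (hJA : J ≤ A)
    (hSA : S ≤ A) (hJ : A * J ^ N * B ≤ A ^ N * C)
    (hS : S ^ (k + 1) * B ≤ A ^ k * C ⊔ J * A ^ k * B) :
    A * S ^ ((k + 1) * N) * B ≤ A ^ ((k + 1) * N) * C := by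
  have key (n : ℕ) : A * S ^ ((k + 1) * n) * B ≤
      A ^ ((k + 1) * n) * C ⊔ A ^ (k * n) * (A * J ^ n * B) := by
    induction n with
    | zero => simp
    | succ n ih =>
      calc A * S ^ ((k + 1) * (n + 1)) * B
          = S ^ (k + 1) * (A * S ^ ((k + 1) * n) * B) := by ring
        _ ≤ S ^ (k + 1) * (A ^ ((k + 1) * n) * C ⊔ A ^ (k * n) * (A * J ^ n * B)) := by gcongr
        _ = S ^ (k + 1) * (A ^ ((k + 1) * n) * C) ⊔
              A ^ (k * n) * (A * J ^ n) * (S ^ (k + 1) * B) := by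
            rw [Ideal.mul_sup]
            congr 1
            ring
        _ ≤ A ^ (k + 1) * (A ^ ((k + 1) * n) * C) ⊔
              A ^ (k * n) * (A * J ^ n) * (A ^ k * C ⊔ J * A ^ k * B) := by gcongr
        _ ≤ _ := by
            rw [Ideal.mul_sup]
            refine sup_le (le_sup_of_le_left (le_of_eq (by ring))) (sup_le
              (le_sup_of_le_left ?_) (le_sup_of_le_right (le_of_eq (by ring))))
            calc A ^ (k * n) * (A * J ^ n) * (A ^ k * C)
                ≤ A ^ (k * n) * (A * A ^ n) * (A ^ k * C) := by gcongr
              _ = A ^ ((k + 1) * (n + 1)) * C := by ring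
  refine (key N).trans (sup_le le_rfl ?_)
  calc A ^ (k * N) * (A * J ^ N * B) ≤ A ^ (k * N) * (A ^ N * C) := by gcongr
    _ = A ^ ((k + 1) * N) * C := by ring

theorem coeff_pow_succ_mul_coeff_mem (f g : R[X]) (i j : ℕ) :
    f.coeff i ^ (j + 1) * g.coeff j ∈ polyContent f ^ j * polyContent (f * g) ⊔
      lowerContent f i * polyContent f ^ j * polyContent g := by
  induction j using Nat.strong_induction_on with
  | _ j ih =>
  have hsum : f.coeff i ^ (j + 1) * g.coeff j = f.coeff i ^ j * (f * g).coeff (i + j) -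
      ∑ p ∈ (Finset.HasAntidiagonal.antidiagonal (i + j)).erase (i, j),
        f.coeff i ^ j * (f.coeff p.1 * g.coeff p.2) := by
    rw [coeff_mul, ← Finset.add_sum_erase _ _
        (Finset.HasAntidiagonal.mem_antidiagonal.2 rfl : (i, j) ∈ _),
      mul_add, Finset.mul_sum]
    ring
  rw [hsum]
  have hpow (n : ℕ) : f.coeff i ^ n ∈ polyContent f ^ n :=
    Ideal.pow_mem_pow (coeff_mem_polyContent f i) n
  refine sub_mem (Ideal.mem_sup_left (Ideal.mul_mem_mul (hpow j) (coeff_mem_polyContent _ _)))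
    (sum_mem ?_)
  rintro ⟨p, q⟩ hpq
  simp only [Finset.mem_erase, Finset.HasAntidiagonal.mem_antidiagonal, ne_eq, Prod.mk.injEq] at hpq
  obtain hp | hp := lt_or_ge p i
  · rw [← mul_assoc, mul_comm (f.coeff i ^ j)]
    exact Ideal.mem_sup_right (Ideal.mul_mem_mul
      (Ideal.mul_mem_mul (coeff_mem_lowerContent f hp) (hpow j)) (coeff_mem_polyContent g q))
  · obtain ⟨d, rfl⟩ : ∃ d, j = d + (q + 1) := ⟨j - (q + 1), by omega⟩
    have hmem := Ideal.mul_mem_mul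
      (Ideal.mul_mem_mul (hpow d) (coeff_mem_polyContent f p)) (ih q (by omega))
    rw [Ideal.mul_sup] at hmem
    convert hmem using 1
    · congr 1 <;> ring
    · ring

theorem span_coeff_pow_mul_polyContent_le (f g : R[X]) (i : ℕ) :
    Ideal.span {f.coeff i} ^ (g.natDegree + 1) * polyContent g ≤
      polyContent f ^ g.natDegree * polyContent (f * g) ⊔
        lowerContent f i * polyContent f ^ g.natDegree * polyContent g := by
  rw [Ideal.span_singleton_pow, polyContent.eq_1 g, Ideal.span_mul_span', Ideal.span_le,
    ← polyContent.eq_1 g]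
  rintro _ ⟨_, rfl, _, ⟨j, rfl⟩, rfl⟩
  rw [SetLike.mem_coe]
  obtain hj | hj := lt_or_ge g.natDegree j
  · simp [coeff_eq_zero_of_natDegree_lt hj]
  · obtain ⟨d, hd⟩ := Nat.exists_eq_add_of_le hj
    have hmem := Ideal.mul_mem_mul (Ideal.pow_mem_pow (coeff_mem_polyContent f i) d)
      (coeff_pow_succ_mul_coeff_mem f g i j)
    rw [Ideal.mul_sup] at hmem
    rw [hd]
    convert hmem using 1
    · congr 1 <;> ring
    · ring

theorem exists_mul_lowerContent_pow_mul_le (f g : R[X]) (i : ℕ) :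
    ∃ N : ℕ, polyContent f * lowerContent f i ^ N * polyContent g ≤
      polyContent f ^ N * polyContent (f * g) := by
  induction i with
  | zero => exact ⟨1, by simp [lowerContent_zero]⟩
  | succ i ih =>
    obtain ⟨N, hN⟩ := ih
    refine ⟨_, mul_pow_mul_le_of_pow_mul_le_sup (k := g.natDegree)
      (lowerContent_le_polyContent f i) (lowerContent_le_polyContent f (i + 1)) hN ?_⟩
    have hle := lowerContent_le_polyContent f (i + 1)
    rw [lowerContent_succ] at hle ⊢
    refine (mul_le_mul_left (sup_pow_succ_le _ _ _) _).trans ?_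
    rw [Ideal.sup_mul]
    refine sup_le (span_coeff_pow_mul_polyContent_le f g i) (le_sup_of_le_right ?_)
    gcongr

end

/-- **Dedekind–Mertens Lemma.** For every pair of polynomials `f, g ∈ R[X]` there is a
natural number `n ≥ 1` such that `c(f)^n · c(g) = c(f)^(n-1) · c(f·g)`. -/
theorem dedekind_mertens {R : Type*} [CommRing R] (f g : Polynomial R) :
    ∃ n : ℕ, 1 ≤ n ∧
      polyContent f ^ n * polyContent g = polyContent f ^ (n - 1) * polyContent (f * g) := by
  obtain ⟨N, hN⟩ := exists_mul_lowerContent_pow_mul_le f g (f.natDegree + 1)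
  refine ⟨N + 1, by omega, le_antisymm ?_ ?_⟩
  · rw [Nat.add_sub_cancel, pow_succ']
    refine le_trans ?_ hN
    gcongr
    exact polyContent_le_lowerContent f
  · rw [Nat.add_sub_cancel, pow_succ, mul_assoc]
    gcongr
    exact polyContent_mul_le f g
end

section
/- Let R be a nontrivial commutative ring and S a commutative additive monoid, and let B = R[S] be the monoid algebra. Then B has McCoy's property — that is, for every g ∈ B, g is a zero-divisor of B if and only if there exists a nonzero r ∈ R with r·g = 0 — if and only if S is cancellative and torsion-free. -/
/-- A cancellative torsion-free commutative monoid has unique sums. -/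
theorem UniqueSums.of_isAddTorsionFree (S : Type*) [AddCommMonoid S] [IsCancelAdd S]
    [IsAddTorsionFree S] : UniqueSums S where
  uniqueAdd_of_nonempty {A B} hA hB := by
    classical
    let M : AddSubmonoid S := AddSubmonoid.closure ((A ∪ B : Finset S) : Set S)
    have hAM : ∀ a ∈ A, a ∈ M := fun a ha ↦ AddSubmonoid.subset_closure (by simp [ha])
    have hBM : ∀ b ∈ B, b ∈ M := fun b hb ↦ AddSubmonoid.subset_closure (by simp [hb])
    have : AddMonoid.FG M := AddMonoid.closure_finset_fg _
    have : IsAddTorsionFree M :=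
      Function.Injective.isAddTorsionFree M.subtype Subtype.val_injective
    let _ : AddCancelCommMonoid M :=
      { (inferInstance : AddCommMonoid M) with
        add_left_cancel := fun a b c h ↦ Subtype.ext (add_left_cancel congr(($h : S))) }
    have : TwoUniqueSums M := AffineAddMonoid.to_twoUniqueSums
    obtain ⟨a, ha⟩ := hA
    obtain ⟨b, hb⟩ := hB
    obtain ⟨a₀, ha₀, b₀, hb₀, h⟩ := UniqueSums.uniqueAdd_of_nonempty
      (A := A.subtype (· ∈ M)) (B := B.subtype (· ∈ M))
      ⟨⟨a, hAM a ha⟩, by simpa⟩ ⟨⟨b, hBM b hb⟩, by simpa⟩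
    refine ⟨a₀, by simpa using ha₀, b₀, by simpa using hb₀, fun x y hx hy hxy ↦ ?_⟩
    have := h (a := ⟨x, hAM x hx⟩) (b := ⟨y, hBM y hy⟩) (by simpa) (by simpa) (Subtype.ext hxy)
    simpa [Subtype.ext_iff] using this

namespace AddMonoidAlgebra

variable {R S : Type*} [CommRing R]

/-- Suppose that every multiple of `h` by a coefficient of `g` vanishes as soon as its support is
strictly smaller than that of `h`. Then `g * h = 0` forces all coefficients of `g` to
annihilate `h`. -/
theorem coeff_smul_eq_zero_of_mul_eq_zero [Add S] [UniqueSums S] {g h : AddMonoidAlgebra R S}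
    (hmin : ∀ s, (g.coeff s • h).coeff.support ⊂ h.coeff.support → g.coeff s • h = 0)
    (hgh : g * h = 0) (s : S) : g.coeff s • h = 0 := by
  classical
  induction hA : g.coeff.support using Finset.eraseInduction generalizing g with
  | _ A ih =>
  subst hA
  by_cases hh : h = 0
  · simp [hh]
  by_cases hg : g = 0
  · simp [hg]
  rw [← coeff_eq_zero, ← ne_eq, ← Finsupp.support_nonempty_iff] at hh hg
  obtain ⟨a, ha, b, hb, hab⟩ := UniqueSums.uniqueAdd_of_nonempty hg hh
  have hprod : g.coeff a * h.coeff b = 0 := by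
    rw [← coeff_mul_add_of_uniqueAdd hab, hgh]; simp
  have hah : g.coeff a • h = 0 := by
    refine hmin a (Finset.ssubset_iff_subset_ne.2 ⟨Finsupp.support_smul, fun heq ↦ ?_⟩)
    rw [← heq, Finsupp.mem_support_iff] at hb
    exact hb (by simpa using hprod)
  obtain rfl | hsa := eq_or_ne s a
  · exact hah
  have herase : ∀ t, (g.erase a).coeff t = if t = a then 0 else g.coeff t := fun t ↦ by
    simp [Finsupp.erase_apply]
  have hsingle : single a (g.coeff a) * h = 0 := by
    ext x
    rw [coeff_mul, coeff_single, Finsupp.sum_single_index (by simp)]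
    refine Finset.sum_eq_zero fun y _ ↦ ?_
    have : g.coeff a * h.coeff y = 0 := by simpa using congr(($hah).coeff y)
    simp [this]
  have := ih a ha (g := g.erase a) (fun t ↦ ?_) ?_ (by simp)
  · simpa [herase, hsa] using this
  · rw [herase]
    split_ifs
    · simp
    · exact hmin t
  · rw [← single_add_erase a g, add_mul, hsingle, zero_add] at hgh
    exact hgh

/-- **McCoy's theorem** for monoids with unique sums. -/
theorem exists_smul_eq_zero_of_mul_eq_zero [Add S] [UniqueSums S] {g : AddMonoidAlgebra R S}
    (hg : ∃ h : AddMonoidAlgebra R S, h ≠ 0 ∧ g * h = 0) : ∃ r : R, r ≠ 0 ∧ r • g = 0 := by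
  obtain ⟨h, ⟨hh, hgh⟩, hmin⟩ :=
    (measure fun h : AddMonoidAlgebra R S ↦ h.coeff.support.card).wf.has_min
      {h | h ≠ 0 ∧ g * h = 0} hg
  have hcoeff := coeff_smul_eq_zero_of_mul_eq_zero (g := g) (h := h) (fun s hs ↦ by
    by_contra hne
    exact hmin _ ⟨hne, by rw [mul_smul_comm, hgh, smul_zero]⟩ (Finset.card_lt_card hs)) hgh
  obtain ⟨b, hb⟩ := Finsupp.support_nonempty_iff.2 (coeff_eq_zero.not.2 hh)
  refine ⟨h.coeff b, Finsupp.mem_support_iff.1 hb, ?_⟩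
  ext s
  simpa [mul_comm] using congr(($(hcoeff s)).coeff b)

/-- No nonzero scalar annihilates a difference of two distinct monomials. -/
theorem eq_zero_of_smul_single_sub_single_eq_zero {s t : S} (hst : s ≠ t) {r : R}
    (h : r • (single s 1 - single t 1 : AddMonoidAlgebra R S) = 0) : r = 0 := by
  classical
  simpa [Finsupp.single_apply, hst.symm] using congr(($h).coeff s)

/-- In a cancellative monoid, if `s ≠ t` have a common positive multiple `n • s = n • t`, then the
difference of the corresponding monomials is a zero-divisor. -/
theorem exists_single_sub_single_mul_eq_zero [Nontrivial R] [AddCommMonoid S] [IsCancelAdd S]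
    {s t : S} {n : ℕ} (hn : 1 ≤ n) (h : n • s = n • t) :
    ∃ f : AddMonoidAlgebra R S, f ≠ 0 ∧ (single s 1 - single t 1) * f = 0 := by
  classical
  have hex : ∃ n, 1 ≤ n ∧ n • s = n • t := ⟨n, hn, h⟩
  obtain ⟨hm, hmst⟩ := Nat.find_spec hex
  have hmin := fun k ↦ Nat.find_min hex (m := k)
  generalize Nat.find hex = m at *
  refine ⟨∑ i ∈ Finset.range m, single s 1 ^ i * single t 1 ^ (m - 1 - i), fun h0 ↦ ?_, ?_⟩
  · have hcoeff := congr(($h0).coeff ((m - 1) • t))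
    simp only [single_pow, single_mul_single, one_pow, mul_one, coeff_sum, coeff_single,
      Finsupp.finsetSum_apply, coeff_zero, Finsupp.coe_zero, Pi.zero_apply] at hcoeff
    rw [Finset.sum_eq_single 0] at hcoeff
    · simp at hcoeff
    · intro i hi hi0
      rw [Finset.mem_range] at hi
      refine Finsupp.single_eq_of_ne fun heq ↦ hmin i hi ⟨by lia, ?_⟩
      rw [show m - 1 = i + (m - 1 - i) by lia, add_nsmul] at heq
      simpa using heq.symm
    · simp; lia
  · rw [mul_comm, Commute.geom_sum₂_mul (Commute.all _ _), single_pow, single_pow, hmst, sub_self]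

end AddMonoidAlgebra

/-- **McCoy's property for monoid algebras.** For a nontrivial commutative ring `R` and a
commutative additive monoid `S`, the monoid algebra `B = R[S]` satisfies McCoy's property
(an element `g ∈ B` is a zero-divisor of `B` iff `r·g = 0` for some nonzero `r ∈ R`)
if and only if `S` is cancellative and torsion-free. -/
theorem mcCoy_iff_cancellative_torsionFree
    (R S : Type*) [CommRing R] [Nontrivial R] [AddCommMonoid S] :
    (∀ g : AddMonoidAlgebra R S,
        (∃ h : AddMonoidAlgebra R S, h ≠ 0 ∧ g * h = 0) ↔
        (∃ r : R, r ≠ 0 ∧ algebraMap R (AddMonoidAlgebra R S) r * g = 0)) ↔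
    ((∀ s t u : S, s + u = t + u → s = t) ∧
      (∀ n : ℕ, 1 ≤ n → ∀ s t : S, n • s = n • t → s = t)) := by
  simp_rw [← Algebra.smul_def]
  constructor
  · intro hMcCoy
    have hcancel : ∀ s t u : S, s + u = t + u → s = t := by
      intro s t u h
      by_contra hst
      obtain ⟨r, hr, hrg⟩ := (hMcCoy (.single s 1 - .single t 1)).1
        ⟨.single u 1, by simp, by simp [sub_mul, AddMonoidAlgebra.single_mul_single, h]⟩
      exact hr (AddMonoidAlgebra.eq_zero_of_smul_single_sub_single_eq_zero hst hrg)
    refine ⟨hcancel, fun n hn s t h ↦ ?_⟩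
    by_contra hst
    have : IsRightCancelAdd S := ⟨fun u s t h ↦ hcancel s t u h⟩
    have : IsCancelAdd S := AddCommMagma.IsRightCancelAdd.toIsCancelAdd S
    obtain ⟨r, hr, hrg⟩ := (hMcCoy _).1
      (AddMonoidAlgebra.exists_single_sub_single_mul_eq_zero hn h)
    exact hr (AddMonoidAlgebra.eq_zero_of_smul_single_sub_single_eq_zero hst hrg)
  · rintro ⟨hcancel, htorsion⟩ g
    have : IsRightCancelAdd S := ⟨fun u s t h ↦ hcancel s t u h⟩
    have : IsCancelAdd S := AddCommMagma.IsRightCancelAdd.toIsCancelAdd S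
    have : IsAddTorsionFree S :=
      ⟨fun n hn s t h ↦ htorsion n (Nat.one_le_iff_ne_zero.2 hn) s t h⟩
    have := UniqueSums.of_isAddTorsionFree S
    refine ⟨AddMonoidAlgebra.exists_smul_eq_zero_of_mul_eq_zero, fun ⟨r, hr, hrg⟩ ↦
      ⟨.single 0 r, by simpa using hr, ?_⟩⟩
    rw [mul_comm, ← hrg, Algebra.smul_def]
    rfl
end

section
/- Let R be a commutative ring and B a commutative R-algebra such that (1) for every prime ideal p of R the extended ideal pB is a prime ideal of B, and (2) pB ∩ R = p for every prime ideal p of R. Then the map p ↦ pB is a bijection from Min(R) onto Min(B). -/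
/-- Let `B` be a commutative `R`-algebra such that every prime `p` of `R` extends to a
prime `pB` of `B` and `pB ∩ R = p` for every prime `p` of `R`. Then `p ↦ pB` is a
bijection from `Min(R)` onto `Min(B)`. -/
theorem minimalPrimes_bijOn_map
    (R B : Type*) [CommRing R] [CommRing B] [Algebra R B]
    (h1 : ∀ p : Ideal R, p.IsPrime → (p.map (algebraMap R B)).IsPrime)
    (h2 : ∀ p : Ideal R, p.IsPrime → (p.map (algebraMap R B)).comap (algebraMap R B) = p) :
    Set.BijOn (fun p : Ideal R => p.map (algebraMap R B))
      (minimalPrimes R) (minimalPrimes B) := by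
  rw [minimalPrimes_eq_minimals, minimalPrimes_eq_minimals]
  refine ⟨fun p hp => ⟨h1 p hp.prop, fun q hq hqp => ?_⟩, fun p hp q hq hpq => ?_,
    fun q hq => ?_⟩
  · exact Ideal.map_le_iff_le_comap.2 <| hp.le_of_le (hq.comap (algebraMap R B)) <|
      (Ideal.comap_mono hqp).trans (h2 p hp.prop).le
  · rw [← h2 p hp.prop, ← h2 q hq.prop]
    exact congrArg (Ideal.comap (algebraMap R B)) hpq
  · have hc : (q.comap (algebraMap R B)).IsPrime := hq.prop.comap _
    refine ⟨q.comap (algebraMap R B), ⟨hc, fun p hp hpq => ?_⟩,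
      hq.eq_of_le (h1 _ hc) Ideal.map_comap_le⟩
    exact (Ideal.comap_mono <| hq.le_of_le (h1 p hp) (Ideal.map_le_iff_le_comap.2 hpq)).trans
      (h2 p hp).le
end

section
/- Let R be a commutative ring and B a weak content R-algebra that is faithfully flat as an R-module. Then the map p ↦ pB is a bijection from Min(R) onto Min(B). -/
/-- The content `c(f)` of an element `f` of a commutative `R`-algebra `B`: the
intersection of all ideals `I` of `R` with `f ∈ IB`. -/
def contentIdeal (R : Type*) {B : Type*} [CommRing R] [CommRing B] [Algebra R B]
    (f : B) : Ideal R :=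
  sInf {I : Ideal R | f ∈ I • (⊤ : Submodule R B)}

/-- `B` is a weak content `R`-algebra: `f ∈ c(f)B` for every `f ∈ B`, and
`c(f)·c(g) ⊆ rad(c(fg))` for all `f, g ∈ B`. -/
structure IsWeakContentAlgebra (R B : Type*) [CommRing R] [CommRing B] [Algebra R B] : Prop where
  mem_content_smul : ∀ f : B, f ∈ contentIdeal R f • (⊤ : Submodule R B)
  weak_content_formula : ∀ f g : B,
    contentIdeal R f * contentIdeal R g ≤ (contentIdeal R (f * g)).radical

/-- In a weak content algebra, `f` lies in the extension of `I` iff its content lies in `I`. -/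
theorem IsWeakContentAlgebra.mem_map_iff {R B : Type*} [CommRing R] [CommRing B] [Algebra R B]
    (hB : IsWeakContentAlgebra R B) (I : Ideal R) (f : B) :
    f ∈ I.map (algebraMap R B) ↔ contentIdeal R f ≤ I := by
  have key : f ∈ I.map (algebraMap R B) ↔ f ∈ I • (⊤ : Submodule R B) := by
    rw [Ideal.smul_top_eq_map, Submodule.restrictScalars_mem]
  rw [key]
  exact ⟨fun h => sInf_le h, fun h => Submodule.smul_mono_left h (hB.mem_content_smul f)⟩

/-- Primes extend to primes in a weak content algebra, as soon as their extension is proper. -/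
theorem IsWeakContentAlgebra.isPrime_map {R B : Type*} [CommRing R] [CommRing B] [Algebra R B]
    (hB : IsWeakContentAlgebra R B) {p : Ideal R} (hp : p.IsPrime)
    (hne : p.map (algebraMap R B) ≠ ⊤) : (p.map (algebraMap R B)).IsPrime := by
  refine ⟨hne, fun {f g} h => ?_⟩
  simp only [hB.mem_map_iff] at h ⊢
  exact hp.mul_le.mp ((hB.weak_content_formula f g).trans (hp.radical_le_iff.mpr h))

/-- If `B` is a weak content `R`-algebra which is faithfully flat as an `R`-module, then
`p ↦ pB` is a bijection from `Min(R)` onto `Min(B)`. -/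
theorem minimalPrimes_bijOn_map_of_weakContent_faithfullyFlat
    (R B : Type*) [CommRing R] [CommRing B] [Algebra R B]
    (hB : IsWeakContentAlgebra R B) (hff : Module.FaithfullyFlat R B) :
    Set.BijOn (fun p : Ideal R => p.map (algebraMap R B))
      (minimalPrimes R) (minimalPrimes B) := by
  have hcomap (p : Ideal R) : (p.map (algebraMap R B)).comap (algebraMap R B) = p :=
    Ideal.comap_map_eq_self_of_faithfullyFlat p
  have hprime {p : Ideal R} (hp : p.IsPrime) : (p.map (algebraMap R B)).IsPrime := by
    refine hB.isPrime_map hp fun h => hp.ne_top ?_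
    rw [← hcomap p, h, Ideal.comap_top]
  refine ⟨fun p hp => ?_, fun p _ q _ h => ?_, fun Q hQ => ?_⟩
  · refine ⟨⟨hprime hp.1.1, bot_le⟩, fun Q hQ hle => ?_⟩
    have := hQ.1
    exact Ideal.map_le_iff_le_comap.mpr <| hp.2 ⟨Ideal.comap_isPrime _ Q, bot_le⟩ <|
      (Ideal.comap_mono hle).trans (hcomap p).le
  · rw [← hcomap p, ← hcomap q]
    exact congrArg (Ideal.comap (algebraMap R B)) h
  · have := hQ.1.1
    obtain ⟨p, hp, hle⟩ :=
      Ideal.exists_minimalPrimes_le (bot_le : ⊥ ≤ Q.comap (algebraMap R B))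
    have hpQ : p.map (algebraMap R B) ≤ Q := Ideal.map_le_iff_le_comap.mpr hle
    exact ⟨p, hp, hpQ.antisymm (hQ.2 ⟨hprime hp.1.1, bot_le⟩ hpQ)⟩
end

section
/- Let R be a commutative Noetherian ring and n a natural number. Then the map p ↦ p·R[[X₁,…,Xₙ]] is a bijection from Min(R) onto Min(R[[X₁,…,Xₙ]]), where R[[X₁,…,Xₙ]] is the formal power series ring in n variables over R. -/
namespace MvPowerSeries

variable {σ R : Type*} [CommRing R]

/-- Extending a finitely generated ideal to a power series ring gives the ideal of all power series
with coefficients in that ideal. -/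
theorem mem_map_algebraMap_iff_of_fg {I : Ideal R} (hI : I.FG) {f : MvPowerSeries σ R} :
    f ∈ I.map (algebraMap R (MvPowerSeries σ R)) ↔ ∀ m, coeff m f ∈ I := by
  constructor
  · intro hf
    have hle : I.map (algebraMap R (MvPowerSeries σ R)) ≤
        RingHom.ker (map (σ := σ) (Ideal.Quotient.mk I)) := by
      refine Ideal.map_le_iff_le_comap.mpr fun r hr => ?_
      rw [Ideal.mem_comap, RingHom.mem_ker, algebraMap_apply, map_C]
      simp [Ideal.Quotient.eq_zero_iff_mem.mpr hr]
    intro m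
    rw [← Ideal.Quotient.eq_zero_iff_mem, ← coeff_map, RingHom.mem_ker.mp (hle hf), coeff_zero]
  · intro hf
    obtain ⟨s, rfl⟩ := hI
    have hcoeff : ∀ m, ∃ c : R → R, ∑ a ∈ s, c a • a = coeff m f := fun m => by
      obtain ⟨c, -, hc⟩ := Submodule.mem_span_finset.mp (hf m)
      exact ⟨c, hc⟩
    choose c hc using hcoeff
    have hsum : f = ∑ a ∈ s, algebraMap R (MvPowerSeries σ R) a *
        (show MvPowerSeries σ R from fun m => c m a) := by
      ext m
      rw [← hc m, map_sum]
      refine Finset.sum_congr rfl fun a _ => ?_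
      rw [← Algebra.smul_def, coeff_smul, smul_eq_mul, mul_comm]
      rfl
    rw [hsum]
    exact Ideal.sum_mem _ fun a ha =>
      Ideal.mul_mem_right _ _ (Ideal.mem_map_of_mem _ (Ideal.subset_span ha))

theorem map_algebraMap_eq_ker_of_fg {I : Ideal R} (hI : I.FG) :
    I.map (algebraMap R (MvPowerSeries σ R)) =
      RingHom.ker (map (σ := σ) (Ideal.Quotient.mk I)) := by
  ext f
  simp only [mem_map_algebraMap_iff_of_fg hI, RingHom.mem_ker, MvPowerSeries.ext_iff, coeff_map,
    coeff_zero, Ideal.Quotient.eq_zero_iff_mem]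

theorem isPrime_map_algebraMap_of_fg {p : Ideal R} [p.IsPrime] (hp : p.FG) :
    (p.map (algebraMap R (MvPowerSeries σ R))).IsPrime := by
  rw [map_algebraMap_eq_ker_of_fg hp]
  have : IsDomain (MvPowerSeries σ (R ⧸ p)) := NoZeroDivisors.to_isDomain _
  exact RingHom.ker_isPrime _

theorem comap_map_algebraMap_of_fg {I : Ideal R} (hI : I.FG) :
    (I.map (algebraMap R (MvPowerSeries σ R))).comap (algebraMap R (MvPowerSeries σ R)) = I := by
  refine le_antisymm (fun r hr => ?_) Ideal.le_comap_map
  simpa [algebraMap_apply] using (mem_map_algebraMap_iff_of_fg hI).mp hr 0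

/-- Over a Noetherian ring, extension of ideals is a bijection from the minimal primes of the ring
to those of its power series ring in any set of variables. -/
theorem bijOn_map_algebraMap_minimalPrimes [IsNoetherianRing R] :
    Set.BijOn (fun p : Ideal R => p.map (algebraMap R (MvPowerSeries σ R)))
      (minimalPrimes R) (minimalPrimes (MvPowerSeries σ R)) := by
  have hfg (I : Ideal R) : I.FG := IsNoetherian.noetherian I
  refine ⟨fun p hp => ?_, fun p _ q _ hpq => ?_, fun Q hQ => ?_⟩
  · have := hp.1.1
    refine ⟨⟨isPrime_map_algebraMap_of_fg (hfg p), bot_le⟩, fun Q hQ hle => ?_⟩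
    have := hQ.1
    refine Ideal.map_le_iff_le_comap.mpr (hp.2 ⟨Ideal.comap_isPrime _ Q, bot_le⟩ ?_)
    exact (Ideal.comap_mono hle).trans (comap_map_algebraMap_of_fg (hfg p)).le
  · dsimp only at hpq
    rw [← comap_map_algebraMap_of_fg (σ := σ) (hfg p), hpq, comap_map_algebraMap_of_fg (hfg q)]
  · have := hQ.1.1
    obtain ⟨p, hp, hle⟩ := Ideal.exists_minimalPrimes_le
      (bot_le : ⊥ ≤ Q.comap (algebraMap R (MvPowerSeries σ R)))
    have := hp.1.1
    have hmap := Ideal.map_le_iff_le_comap.mpr hle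
    exact ⟨p, hp, le_antisymm hmap (hQ.2 ⟨isPrime_map_algebraMap_of_fg (hfg p), bot_le⟩ hmap)⟩

end MvPowerSeries

/-- For a commutative Noetherian ring `R` and `n : ℕ`, the map `p ↦ p·R[[X₁,…,Xₙ]]` is a
bijection from `Min(R)` onto `Min(R[[X₁,…,Xₙ]])`. -/
theorem minimalPrimes_bijOn_map_mvPowerSeries
    (R : Type*) [CommRing R] [IsNoetherianRing R] (n : ℕ) :
    Set.BijOn (fun p : Ideal R => p.map (algebraMap R (MvPowerSeries (Fin n) R)))
      (minimalPrimes R) (minimalPrimes (MvPowerSeries (Fin n) R)) :=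
  MvPowerSeries.bijOn_map_algebraMap_minimalPrimes
end

section
/- Let B be a content R-algebra. If Z(R) = p₁ ∪ … ∪ pₙ where each pᵢ is a prime ideal belonging to Ass_R(R), then Z(B) = p₁B ∪ … ∪ pₙB and each pᵢB belongs to Ass_B(B); in particular, if R has very few zero-divisors then B has very few zero-divisors. -/
/-- `B` is a content `R`-algebra: (i) `f ∈ c(f)B` for all `f`; (ii) `c(rf) = r·c(f)`
and the ideal generated by all the contents is `R`; (iii) the Dedekind–Mertens content
formula holds. -/
structure IsContentAlgebra (R B : Type*) [CommRing R] [CommRing B] [Algebra R B] : Prop where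
  mem_content_smul : ∀ f : B, f ∈ contentIdeal R f • (⊤ : Submodule R B)
  content_smul : ∀ (r : R) (f : B),
    contentIdeal R (algebraMap R B r * f) = Ideal.span {r} * contentIdeal R f
  content_top : (⨆ f : B, contentIdeal R f) = ⊤
  dedekind_mertens : ∀ f g : B, ∃ n : ℕ, 1 ≤ n ∧
    contentIdeal R f ^ n * contentIdeal R g =
      contentIdeal R f ^ (n - 1) * contentIdeal R (f * g)

/-- The set of zero-divisors of `R`. -/
def zdSet (R : Type*) [CommRing R] : Set R := {r : R | ∃ s : R, s ≠ 0 ∧ r * s = 0}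

namespace IsContentAlgebra

variable {R B : Type*} [CommRing R] [CommRing B] [Algebra R B]

theorem contentIdeal_le_iff (hB : IsContentAlgebra R B) {f : B} {I : Ideal R} :
    contentIdeal R f ≤ I ↔ f ∈ I.map (algebraMap R B) := by
  have key : f ∈ I.map (algebraMap R B) ↔ f ∈ I • (⊤ : Submodule R B) := by
    rw [Ideal.smul_top_eq_map]; rfl
  rw [key]
  exact ⟨fun h => Submodule.smul_mono_left h (hB.mem_content_smul f), fun h => sInf_le h⟩

theorem contentIdeal_eq_bot_iff (hB : IsContentAlgebra R B) {f : B} :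
    contentIdeal R f = ⊥ ↔ f = 0 := by
  rw [← le_bot_iff, hB.contentIdeal_le_iff, Ideal.map_bot, Ideal.mem_bot]

theorem exists_pow_mul_contentIdeal_le (hB : IsContentAlgebra R B) (f g : B) :
    ∃ n : ℕ, contentIdeal R f ^ n * contentIdeal R g ≤ contentIdeal R (f * g) := by
  obtain ⟨n, -, hn⟩ := hB.dedekind_mertens f g
  exact ⟨n, hn.trans_le Ideal.mul_le_right⟩

theorem isPrime_map (hB : IsContentAlgebra R B) {p : Ideal R} (hp : p.IsPrime) :
    (p.map (algebraMap R B)).IsPrime := by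
  refine ⟨fun h => hp.ne_top (top_le_iff.mp ?_), fun {f g} hfg => ?_⟩
  · rw [← hB.content_top]
    exact iSup_le fun f => hB.contentIdeal_le_iff.mpr (h ▸ Submodule.mem_top)
  · obtain ⟨n, hn⟩ := hB.exists_pow_mul_contentIdeal_le f g
    rw [← hB.contentIdeal_le_iff, ← hB.contentIdeal_le_iff]
    exact (hp.mul_le.mp (hn.trans (hB.contentIdeal_le_iff.mpr hfg))).imp_left hp.le_of_pow_le

theorem colon_algebraMap_le (hB : IsContentAlgebra R B) (x : R) :
    (⊥ : Ideal B).colon {algebraMap R B x} ≤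
      ((⊥ : Ideal R).colon {x}).map (algebraMap R B) := by
  intro f hf
  have hxf : algebraMap R B x * f = 0 := by
    simpa [mul_comm] using Submodule.mem_colon_singleton.mp hf
  have h := hB.content_smul x f
  rw [hxf, hB.contentIdeal_eq_bot_iff.mpr rfl] at h
  rw [← hB.contentIdeal_le_iff]
  intro r hr
  have hxr : x * r ∈ (⊥ : Ideal R) := h ▸ Ideal.mul_mem_mul (Ideal.mem_span_singleton_self x) hr
  simpa [mul_comm] using hxr

theorem map_mem_associatedPrimes (hB : IsContentAlgebra R B) {p : Ideal R}
    (hp : p ∈ associatedPrimes R R) : p.map (algebraMap R B) ∈ associatedPrimes B B := by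
  obtain ⟨hprime, x, hx⟩ := hp
  have hprimeB := hB.isPrime_map hprime
  refine ⟨hprimeB, algebraMap R B x, le_antisymm ?_ ?_⟩
  · rw [Ideal.map_le_iff_le_comap]
    intro a ha
    rw [hx] at ha
    obtain ⟨k, hk⟩ := ha
    refine ⟨k, ?_⟩
    have hk' : a ^ k * x = 0 := by simpa using hk
    simp [← map_pow, ← map_mul, hk']
  · rw [hprimeB.radical_le_iff]
    exact (hB.colon_algebraMap_le x).trans (Ideal.map_mono (hx ▸ Ideal.le_radical))

end IsContentAlgebra

theorem mem_zdSet_of_pow_mul_eq_zero {R : Type*} [CommRing R] {r s : R} (hs : s ≠ 0) {n : ℕ}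
    (h : r ^ n * s = 0) : r ∈ zdSet R := by
  induction n with
  | zero => exact absurd (by simpa using h) hs
  | succ n ih =>
    by_cases h0 : r ^ n * s = 0
    · exact ih h0
    · exact ⟨_, h0, by rw [← h]; ring⟩

theorem subset_zdSet_of_mem_associatedPrimes {R : Type*} [CommRing R] {p : Ideal R}
    (hp : p ∈ associatedPrimes R R) : (p : Set R) ⊆ zdSet R := by
  obtain ⟨hprime, x, hx⟩ := hp
  have hx0 : x ≠ 0 := by
    rintro rfl
    refine hprime.ne_top (hx.trans (Ideal.radical_eq_top.mpr ?_))
    simp [Ideal.eq_top_iff_one]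
  intro a ha
  rw [SetLike.mem_coe, hx] at ha
  obtain ⟨k, hk⟩ := ha
  exact mem_zdSet_of_pow_mul_eq_zero hx0 (by simpa using hk)

theorem IsContentAlgebra.contentIdeal_subset_zdSet {R B : Type*} [CommRing R] [CommRing B]
    [Algebra R B] (hB : IsContentAlgebra R B) {f : B} (hf : f ∈ zdSet B) :
    (contentIdeal R f : Set R) ⊆ zdSet R := by
  obtain ⟨g, hg, hfg⟩ := hf
  obtain ⟨s, hs, hs0⟩ := Submodule.exists_mem_ne_zero_of_ne_bot
    (mt hB.contentIdeal_eq_bot_iff.mp hg)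
  obtain ⟨n, hn⟩ := hB.exists_pow_mul_contentIdeal_le f g
  rw [hfg, hB.contentIdeal_eq_bot_iff.mpr rfl] at hn
  exact fun r hr => mem_zdSet_of_pow_mul_eq_zero hs0
    (hn (Ideal.mul_mem_mul (Ideal.pow_mem_pow hr n) hs))

/-- If `B` is a content `R`-algebra and `Z(R) = p₁ ∪ … ∪ pₙ` with each `pᵢ` a prime in
`Ass_R(R)`, then `Z(B) = p₁B ∪ … ∪ pₙB` and each `pᵢB` belongs to `Ass_B(B)`; in
particular, if `R` has very few zero-divisors then so does `B`. -/
theorem veryFewZeroDivisors_of_isContentAlgebra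
    (R B : Type*) [CommRing R] [CommRing B] [Algebra R B]
    (hB : IsContentAlgebra R B) (n : ℕ) (p : Fin n → Ideal R)
    (hprime : ∀ i, (p i).IsPrime) (hass : ∀ i, p i ∈ associatedPrimes R R)
    (hZ : zdSet R = ⋃ i, (p i : Set R)) :
    zdSet B = (⋃ i, ((p i).map (algebraMap R B) : Set B)) ∧
      ∀ i, (p i).map (algebraMap R B) ∈ associatedPrimes B B := by
  have hassB := fun i => hB.map_mem_associatedPrimes (hass i)
  refine ⟨Set.Subset.antisymm (fun f hf => ?_)
    (Set.iUnion_subset fun i => subset_zdSet_of_mem_associatedPrimes (hassB i)), hassB⟩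
  have hsub : (contentIdeal R f : Set R) ⊆ ⋃ i, (p i : Set R) :=
    hZ ▸ hB.contentIdeal_subset_zdSet hf
  obtain ⟨i₀, -⟩ := Set.mem_iUnion.mp (hsub (contentIdeal R f).zero_mem)
  obtain ⟨i, -, hi⟩ := (Ideal.subset_union_prime (s := Finset.univ) i₀ i₀
    fun i _ _ _ => hprime i).mp (by simpa using hsub)
  exact Set.mem_iUnion.mpr ⟨i, hB.contentIdeal_le_iff.mp hi⟩
end

section
/- Let B be a content R-algebra. If Z(B) = Q₁ ∪ … ∪ Qₙ where each Qᵢ is a prime ideal of B, then Z(R) = (Q₁ ∩ R) ∪ … ∪ (Qₙ ∩ R), where Qᵢ ∩ R denotes the contraction of Qᵢ along the structure map R → B; in particular, if zd(B) = n then zd(R) ≤ n. -/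
/-- `Z(R)` is a union of `n` prime ideals of `R`. -/
def ZdUnion (R : Type*) [CommRing R] (n : ℕ) : Prop :=
  ∃ p : Fin n → Ideal R, (∀ i, (p i).IsPrime) ∧ zdSet R = ⋃ i, (p i : Set R)

/-- `zd(R) = n`: `Z(R)` is a union of `n` prime ideals of `R`, but not a union of fewer
than `n` prime ideals of `R`. -/
def ZdEq (R : Type*) [CommRing R] (n : ℕ) : Prop :=
  ZdUnion R n ∧ ∀ m : ℕ, m < n → ¬ ZdUnion R m

@[simp]
theorem contentIdeal_zero (R B : Type*) [CommRing R] [CommRing B] [Algebra R B] :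
    contentIdeal R (0 : B) = ⊥ :=
  le_bot_iff.mp (sInf_le (Set.mem_ofPred.mpr (Submodule.zero_mem _)))

namespace IsContentAlgebra

variable {R B : Type*} [CommRing R] [CommRing B] [Algebra R B]

theorem eq_zero_of_contentIdeal_eq_bot (hB : IsContentAlgebra R B) {f : B}
    (hf : contentIdeal R f = ⊥) : f = 0 := by
  simpa [hf] using hB.mem_content_smul f

theorem eq_zero_of_algebraMap_eq_zero (hB : IsContentAlgebra R B) {s : R}
    (hs : algebraMap R B s = 0) : s = 0 := by
  have hmul : Ideal.span {s} * ⨆ f : B, contentIdeal R f = ⊥ := by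
    simp [Ideal.mul_iSup, ← hB.content_smul, hs]
  rwa [hB.content_top, Ideal.mul_top, Ideal.span_singleton_eq_bot] at hmul

theorem algebraMap_mem_zdSet_iff (hB : IsContentAlgebra R B) {r : R} :
    algebraMap R B r ∈ zdSet B ↔ r ∈ zdSet R := by
  constructor
  · rintro ⟨b, hb, hrb⟩
    have hc : contentIdeal R b ≠ ⊥ := fun h => hb (hB.eq_zero_of_contentIdeal_eq_bot h)
    obtain ⟨s, hs, hs0⟩ := Submodule.exists_mem_ne_zero_of_ne_bot hc
    refine ⟨s, hs0, ?_⟩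
    have hmul : r * s ∈ Ideal.span {r} * contentIdeal R b :=
      Ideal.mul_mem_mul (Ideal.mem_span_singleton_self r) hs
    rwa [← hB.content_smul, hrb, contentIdeal_zero, Ideal.mem_bot] at hmul
  · rintro ⟨s, hs, hrs⟩
    exact ⟨algebraMap R B s, fun h => hs (hB.eq_zero_of_algebraMap_eq_zero h),
      by rw [← map_mul, hrs, map_zero]⟩

theorem zdSet_eq_iUnion_comap (hB : IsContentAlgebra R B) {ι : Type*} {Q : ι → Ideal B}
    (hQ : zdSet B = ⋃ i, (Q i : Set B)) :
    zdSet R = ⋃ i, ((Q i).comap (algebraMap R B) : Set R) := by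
  ext r
  simp [← hB.algebraMap_mem_zdSet_iff, hQ]

end IsContentAlgebra

theorem ZdUnion.exists_zdEq_le {R : Type*} [CommRing R] {n : ℕ} (h : ZdUnion R n) :
    ∃ m : ℕ, m ≤ n ∧ ZdEq R m := by
  classical
  have hex : ∃ m, ZdUnion R m := ⟨n, h⟩
  exact ⟨Nat.find hex, Nat.find_min' hex h, Nat.find_spec hex, fun _ => Nat.find_min hex⟩

/-- Let `B` be a content `R`-algebra. If `Z(B) = Q₁ ∪ … ∪ Qₙ` with each `Qᵢ` prime, then
`Z(R) = (Q₁ ∩ R) ∪ … ∪ (Qₙ ∩ R)`; in particular `zd(B) = n` implies `zd(R) ≤ n`. -/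
theorem zdSet_eq_iUnion_comap_of_isContentAlgebra
    (R B : Type*) [CommRing R] [CommRing B] [Algebra R B]
    (hB : IsContentAlgebra R B) :
    (∀ (n : ℕ) (Q : Fin n → Ideal B), (∀ i, (Q i).IsPrime) →
      zdSet B = (⋃ i, (Q i : Set B)) →
      zdSet R = ⋃ i, ((Q i).comap (algebraMap R B) : Set R)) ∧
    (∀ n : ℕ, ZdEq B n → ∃ m : ℕ, m ≤ n ∧ ZdEq R m) := by
  refine ⟨fun _ _ _ hQ => hB.zdSet_eq_iUnion_comap hQ, ?_⟩
  rintro n ⟨⟨Q, hprime, hQ⟩, -⟩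
  exact ZdUnion.exists_zdEq_le
    ⟨fun i => (Q i).comap (algebraMap R B), fun i => (hprime i).comap _,
      hB.zdSet_eq_iUnion_comap hQ⟩
end

section
/- Let R be a commutative ring and S a nontrivial commutative, cancellative, torsion-free additive monoid. Then for every natural number n ≥ 1: zd(R[S]) = n if and only if zd(R) = n and R has Property (A). -/
/-- `R` has Property (A): every finitely generated ideal consisting of zero-divisors has
a nonzero annihilator. -/
def PropertyA (R : Type*) [CommRing R] : Prop :=
  ∀ I : Ideal R, I.FG → (I : Set R) ⊆ zdSet R → ∃ r : R, r ≠ 0 ∧ ∀ x ∈ I, r * x = 0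

/-- A cancellative, torsion-free commutative additive monoid has unique sums. -/
theorem uniqueSums_of_isAddTorsionFree (S : Type*) [AddCancelCommMonoid S] [IsAddTorsionFree S] :
    UniqueSums S where
  uniqueAdd_of_nonempty {A B} hA hB := by
    classical
    let T : AddSubmonoid S := AddSubmonoid.closure ((A ∪ B : Finset S) : Set S)
    have : AddMonoid.FG T :=
      (AddMonoid.fg_iff_addSubmonoid_fg T).mpr ⟨A ∪ B, rfl⟩
    have : IsAddTorsionFree T :=
      Function.Injective.isAddTorsionFree T.subtype Subtype.val_injective
    let : AddCancelCommMonoid T :=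
      { T.toAddCommMonoid with
        add_left_cancel := fun _ _ _ h => Subtype.ext (add_left_cancel (congrArg Subtype.val h)) }
    have : TwoUniqueSums T := AffineAddMonoid.to_twoUniqueSums (M := T)
    have hAT (a) (ha : a ∈ A) : a ∈ T := AddSubmonoid.subset_closure (by simp [ha])
    have hBT (b) (hb : b ∈ B) : b ∈ T := AddSubmonoid.subset_closure (by simp [hb])
    obtain ⟨a₀, ha₀, b₀, hb₀, h⟩ := UniqueSums.uniqueAdd_of_nonempty
      (A := A.attach.image fun a : {a // a ∈ A} => (⟨a, hAT a a.2⟩ : T))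
      (B := B.attach.image fun b : {b // b ∈ B} => (⟨b, hBT b b.2⟩ : T)) (by simpa) (by simpa)
    refine ⟨a₀, ?_, b₀, ?_, fun a b ha hb hab => ?_⟩
    · obtain ⟨a, -, rfl⟩ := Finset.mem_image.mp ha₀
      exact a.2
    · obtain ⟨b, -, rfl⟩ := Finset.mem_image.mp hb₀
      exact b.2
    · have := @h ⟨a, hAT a ha⟩ ⟨b, hBT b hb⟩
        (Finset.mem_image.mpr ⟨⟨a, ha⟩, Finset.mem_attach _ _, rfl⟩)
        (Finset.mem_image.mpr ⟨⟨b, hb⟩, Finset.mem_attach _ _, rfl⟩) (Subtype.ext hab)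
      exact ⟨congrArg Subtype.val this.1, congrArg Subtype.val this.2⟩

namespace AddMonoidAlgebra

variable {R S : Type*} [CommRing R] [AddCommMonoid S]

/-- McCoy's theorem: a zero-divisor of `R[S]` is annihilated by a nonzero element of `R`. -/
theorem exists_forall_mul_coeff_eq_zero [UniqueSums S] {f : AddMonoidAlgebra R S}
    (hf : f ∈ zdSet (AddMonoidAlgebra R S)) : ∃ r : R, r ≠ 0 ∧ ∀ s, r * f.coeff s = 0 := by
  classical
  obtain ⟨g, hg, hfg⟩ := hf
  induction hk : g.coeff.support.card using Nat.strong_induction_on generalizing g with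
  | _ k ih =>
  by_cases hall : ∀ s, f.coeff s • g = 0
  · obtain ⟨t, ht⟩ : ∃ t, g.coeff t ≠ 0 := by
      by_contra! h
      exact hg (AddMonoidAlgebra.ext (Finsupp.ext h))
    refine ⟨g.coeff t, ht, fun s => ?_⟩
    simpa [mul_comm] using congrArg (fun x => x.coeff t) (hall s)
  · push Not at hall
    obtain ⟨s₁, hs₁⟩ := hall
    obtain ⟨s, hs, t, ht, hst⟩ := UniqueSums.uniqueAdd_of_nonempty
      (A := f.coeff.support.filter fun s => f.coeff s • g ≠ 0) (B := g.coeff.support)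
      ⟨s₁, by
        simp only [Finset.mem_filter, Finsupp.mem_support_iff]
        exact ⟨fun h => hs₁ (by simp [h]), hs₁⟩⟩
      (Finsupp.support_nonempty_iff.mpr fun h => hg (AddMonoidAlgebra.ext (by simp [h])))
    rw [Finset.mem_filter] at hs
    have hzero : f.coeff s * g.coeff t = 0 := by
      have h := congrArg (fun x => x.coeff (s + t)) hfg
      simp only [coeff_mul, Finsupp.sum] at h
      rw [Finset.sum_eq_single s, Finset.sum_eq_single t] at h
      · simpa using h
      · intro t' ht' hne
        exact if_neg fun e => hne (UniqueSums.toIsCancelAdd.add_left_cancel _ e)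
      · exact fun h => absurd ht h
      · intro s' hs' hne
        refine Finset.sum_eq_zero fun t' ht' => ?_
        split_ifs with e
        · by_cases h0 : f.coeff s' • g = 0
          · simpa using congrArg (fun x => x.coeff t') h0
          · exact absurd (hst (Finset.mem_filter.mpr ⟨hs', h0⟩) ht' e).1 hne
        · rfl
      · exact fun h => absurd hs.1 h
    refine ih _ ?_ (f.coeff s • g) hs.2 (by rw [mul_smul_comm, hfg, smul_zero]) rfl
    rw [← hk]
    refine Finset.card_lt_card ⟨?_, fun h => ?_⟩
    · rw [coeff_smul]
      exact Finsupp.support_smul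
    · exact Finsupp.mem_support_iff.mp (h ht) (by simpa using hzero)

theorem mem_zdSet_of_forall_mul_coeff_eq_zero {f : AddMonoidAlgebra R S} {r : R} (hr : r ≠ 0)
    (h : ∀ s, r * f.coeff s = 0) : f ∈ zdSet (AddMonoidAlgebra R S) := by
  refine ⟨single 0 r, by simpa using hr, ?_⟩
  refine AddMonoidAlgebra.ext (Finsupp.ext fun s => ?_)
  simpa [coeff_mul_single_zero, mul_comm] using h s

theorem single_zero_mem_zdSet_iff [UniqueSums S] {a : R} :
    (single 0 a : AddMonoidAlgebra R S) ∈ zdSet (AddMonoidAlgebra R S) ↔ a ∈ zdSet R := by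
  constructor
  · intro h
    obtain ⟨r, hr, h⟩ := exists_forall_mul_coeff_eq_zero h
    exact ⟨r, hr, by simpa [mul_comm] using h 0⟩
  · rintro ⟨r, hr, h⟩
    refine mem_zdSet_of_forall_mul_coeff_eq_zero hr fun s => ?_
    by_cases hs : s = 0 <;> simp [coeff_single, mul_comm, h, hs]

end AddMonoidAlgebra

/-- Prime avoidance for a family indexed by `Fin n`. -/
theorem exists_le_of_subset_iUnion_prime {R : Type*} [CommRing R] {n : ℕ} {p : Fin n → Ideal R}
    (hp : ∀ i, (p i).IsPrime) {I : Ideal R} (h : (I : Set R) ⊆ ⋃ i, (p i : Set R)) :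
    ∃ i, I ≤ p i := by
  obtain ⟨i₀, -⟩ := Set.mem_iUnion.mp (h I.zero_mem)
  simpa using (Ideal.subset_union_prime (s := Finset.univ) i₀ i₀ fun i _ _ _ => hp i).mp
    (by simpa using h)

section

variable {R S : Type*} [CommRing R] [AddCommMonoid S] [UniqueSums S] {n : ℕ}

open AddMonoidAlgebra

theorem ZdUnion.of_addMonoidAlgebra (h : ZdUnion (AddMonoidAlgebra R S) n) : ZdUnion R n := by
  obtain ⟨P, hP, hZ⟩ := h
  refine ⟨fun i => (P i).comap singleZeroRingHom, fun i => (hP i).comap _, ?_⟩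
  ext a
  rw [← single_zero_mem_zdSet_iff (S := S), hZ]
  simp

theorem PropertyA.of_zdUnion_addMonoidAlgebra [Infinite S]
    (h : ZdUnion (AddMonoidAlgebra R S) n) : PropertyA R := by
  classical
  obtain ⟨P, hP, hZ⟩ := h
  rintro I ⟨A, rfl⟩ hI
  obtain ⟨i, hi⟩ := exists_le_of_subset_iUnion_prime
    (p := fun i => (P i).comap (singleZeroRingHom (M := S))) (fun i => (hP i).comap _)
    (I := Ideal.span A) fun a ha => by
      have := single_zero_mem_zdSet_iff (S := S).mpr (hI ha)
      rw [hZ] at this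
      simpa using this
  let e : A ↪ S := A.equivFin.toEmbedding.trans (Fin.valEmbedding.trans (Infinite.natEmbedding S))
  let f : AddMonoidAlgebra R S := ∑ a : A, single (e a) (a : R)
  have hcoeff (a : A) : f.coeff (e a) = a := by
    simp [f, coeff_sum, Finsupp.single_apply]
  have hf : f ∈ zdSet (AddMonoidAlgebra R S) := by
    rw [hZ]
    refine Set.mem_iUnion.mpr ⟨i, Ideal.sum_mem _ fun a _ => ?_⟩
    have ha : (single 0 (a : R) : AddMonoidAlgebra R S) ∈ P i := hi (Ideal.subset_span a.2)
    simpa [single_mul_single] using (P i).mul_mem_left (single (e a) 1) ha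
  obtain ⟨r, hr, hrf⟩ := exists_forall_mul_coeff_eq_zero hf
  refine ⟨r, hr, fun x hx => ?_⟩
  induction hx using Submodule.span_induction with
  | mem a ha => simpa [hcoeff] using hrf (e ⟨a, ha⟩)
  | zero => simp
  | add x y _ _ hx hy => rw [mul_add, hx, hy, add_zero]
  | smul a x _ hx => rw [smul_eq_mul, mul_left_comm, hx, mul_zero]

theorem ZdUnion.addMonoidAlgebra (h : ZdUnion R n) (hA : PropertyA R) :
    ZdUnion (AddMonoidAlgebra R S) n := by
  classical
  obtain ⟨p, hp, hZ⟩ := h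
  have hmem (i) (f : AddMonoidAlgebra R S) :
      f ∈ RingHom.ker (mapRingHom S (Ideal.Quotient.mk (p i))) ↔ ∀ s, f.coeff s ∈ p i := by
    simp [RingHom.mem_ker, AddMonoidAlgebra.ext_iff, Ideal.Quotient.eq_zero_iff_mem,
      Finsupp.ext_iff]
  refine ⟨fun i => RingHom.ker (mapRingHom S (Ideal.Quotient.mk (p i))), fun i => ?_, ?_⟩
  · have := hp i
    exact RingHom.ker_isPrime _
  ext f
  simp only [Set.mem_iUnion, SetLike.mem_coe, hmem]
  let I : Ideal R := Ideal.span (f.coeff.support.image f.coeff : Finset R)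
  have hI (s) : f.coeff s ∈ I := by
    by_cases hs : f.coeff s = 0
    · simp [hs]
    · exact Ideal.subset_span (Finset.mem_image_of_mem _ (Finsupp.mem_support_iff.mpr hs))
  constructor
  · intro hf
    obtain ⟨r, hr, hrf⟩ := exists_forall_mul_coeff_eq_zero hf
    obtain ⟨i, hi⟩ := exists_le_of_subset_iUnion_prime hp (I := I) fun x hx => by
      rw [← hZ]
      refine ⟨r, hr, ?_⟩
      rw [mul_comm]
      induction hx using Submodule.span_induction with
      | mem a ha =>
        obtain ⟨s, -, rfl⟩ := Finset.mem_image.mp ha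
        exact hrf s
      | zero => simp
      | add x y _ _ hx hy => rw [mul_add, hx, hy, add_zero]
      | smul a x _ hx => rw [smul_eq_mul, mul_left_comm, hx, mul_zero]
    exact ⟨i, fun s => hi (hI s)⟩
  · rintro ⟨i, hi⟩
    have hIp : I ≤ p i := Ideal.span_le.mpr fun x hx => by
      obtain ⟨s, -, rfl⟩ := Finset.mem_image.mp hx
      exact hi s
    obtain ⟨r, hr, hrI⟩ := hA I ⟨_, rfl⟩ fun x hx => by
      rw [hZ]
      exact Set.mem_iUnion.mpr ⟨i, hIp hx⟩
    exact mem_zdSet_of_forall_mul_coeff_eq_zero hr fun s => hrI _ (hI s)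

end

/-- Let `R` be a commutative ring and `S` a nontrivial commutative, cancellative,
torsion-free additive monoid. Then for every `n ≥ 1`, `zd(R[S]) = n` iff `zd(R) = n` and
`R` has Property (A). -/
theorem zd_monoidAlgebra_iff
    (R S : Type*) [CommRing R] [AddCommMonoid S] [Nontrivial S]
    (hcan : ∀ s t u : S, s + u = t + u → s = t)
    (htf : ∀ m : ℕ, 1 ≤ m → ∀ s t : S, m • s = m • t → s = t)
    (n : ℕ) (hn : 1 ≤ n) :
    ZdEq (AddMonoidAlgebra R S) n ↔ (ZdEq R n ∧ PropertyA R) := by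
  have htors : IsAddTorsionFree S :=
    ⟨fun m hm s t h => htf m (Nat.one_le_iff_ne_zero.mpr hm) s t h⟩
  have hcancel : IsCancelAdd S :=
    { add_left_cancel := fun u s t h => hcan s t u (by rwa [add_comm s, add_comm t])
      add_right_cancel := fun u s t h => hcan s t u h }
  have hsums : UniqueSums S :=
    letI : AddCancelCommMonoid S :=
      { ‹AddCommMonoid S› with add_left_cancel := hcancel.add_left_cancel }
    uniqueSums_of_isAddTorsionFree S
  have hinf : Infinite S := by
    obtain ⟨t, ht⟩ := exists_ne (0 : S)
    refine Infinite.of_injective (fun k : ℕ => k • t) ?_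
    intro a b hab
    wlog hle : a ≤ b generalizing a b
    · exact (this hab.symm (le_of_not_ge hle)).symm
    obtain ⟨c, rfl⟩ := Nat.exists_eq_add_of_le hle
    by_contra hne
    have hc : 1 ≤ c := by omega
    refine ht (htf c hc t 0 (hcan _ _ (a • t) ?_))
    simpa [add_nsmul, add_comm] using hab.symm
  constructor
  · rintro ⟨hU, hmin⟩
    have hA := PropertyA.of_zdUnion_addMonoidAlgebra hU
    exact ⟨⟨hU.of_addMonoidAlgebra, fun m hm h => hmin m hm (h.addMonoidAlgebra hA)⟩, hA⟩
  · rintro ⟨⟨hU, hmin⟩, hA⟩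
    exact ⟨hU.addMonoidAlgebra hA, fun m hm h => hmin m hm h.of_addMonoidAlgebra⟩
end

section
/- Let B be a content R-algebra. Then: (1) Nil(B) = Nil(R)B, i.e. the nilradical of B is the extension of the nilradical of R; (2) Z(R) ⊆ Z(B) ⊆ Z(R)B; (3) for every natural number n ≥ 1, every product of n elements of Z(R) equals zero if and only if every product of n elements of Z(B) equals zero. -/
namespace IsContentAlgebra

variable {R B : Type*} [CommRing R] [CommRing B] [Algebra R B]

theorem contentIdeal_zero : contentIdeal R (0 : B) = ⊥ :=
  le_bot_iff.mp (sInf_le (Set.mem_ofPred.mpr (Submodule.zero_mem _)))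

theorem mem_map_contentIdeal (hB : IsContentAlgebra R B) (f : B) :
    f ∈ (contentIdeal R f).map (algebraMap R B) := by
  have h := hB.mem_content_smul f
  rwa [Ideal.smul_top_eq_map] at h

theorem algebraMap_injective (hB : IsContentAlgebra R B) :
    Function.Injective (algebraMap R B) := by
  refine (injective_iff_map_eq_zero _).mpr fun r hr => ?_
  have h : Ideal.span {r} * ⨆ f : B, contentIdeal R f = ⊥ := by
    rw [Ideal.mul_iSup, iSup_eq_bot]
    intro f
    rw [← hB.content_smul, hr, zero_mul, contentIdeal_zero]
  rwa [hB.content_top, Ideal.mul_top, Ideal.span_singleton_eq_bot] at h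

theorem contentIdeal_le_or_le_of_mul_le (hB : IsContentAlgebra R B) {P : Ideal R}
    [hP : P.IsPrime] {f g : B} (h : contentIdeal R (f * g) ≤ P) :
    contentIdeal R f ≤ P ∨ contentIdeal R g ≤ P := by
  obtain ⟨n, -, hfg⟩ := hB.dedekind_mertens f g
  have hle : contentIdeal R f ^ n * contentIdeal R g ≤ P :=
    hfg ▸ Ideal.mul_le_right.trans h
  exact (hP.mul_le.mp hle).imp_left hP.le_of_pow_le

theorem contentIdeal_le_of_pow_succ_le (hB : IsContentAlgebra R B) {P : Ideal R}
    [P.IsPrime] {f : B} (k : ℕ) (h : contentIdeal R (f ^ (k + 1)) ≤ P) :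
    contentIdeal R f ≤ P := by
  induction k with
  | zero => simpa using h
  | succ k ih =>
    rw [pow_succ] at h
    exact (hB.contentIdeal_le_or_le_of_mul_le h).elim ih id

theorem contentIdeal_le_nilradical (hB : IsContentAlgebra R B) {f : B} (hf : IsNilpotent f) :
    contentIdeal R f ≤ nilradical R := by
  obtain ⟨k, hk⟩ := hf
  rw [nilradical_eq_sInf]
  refine le_sInf fun P (hP : P.IsPrime) => hB.contentIdeal_le_of_pow_succ_le k ?_
  rw [pow_succ, hk, zero_mul, contentIdeal_zero]
  exact bot_le

theorem nilradical_eq_map (hB : IsContentAlgebra R B) :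
    nilradical B = (nilradical R).map (algebraMap R B) := by
  refine le_antisymm (fun f hf => ?_) (Ideal.map_le_iff_le_comap.mpr fun r hr => ?_)
  · exact Ideal.map_mono (hB.contentIdeal_le_nilradical hf) (hB.mem_map_contentIdeal f)
  · exact IsNilpotent.map (mem_nilradical.mp hr) (algebraMap R B)

theorem algebraMap_mem_zdSet (hB : IsContentAlgebra R B) {r : R} (hr : r ∈ zdSet R) :
    algebraMap R B r ∈ zdSet B := by
  obtain ⟨s, hs, hrs⟩ := hr
  refine ⟨algebraMap R B s, ?_, by rw [← map_mul, hrs, map_zero]⟩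
  rwa [Ne, map_eq_zero_iff _ hB.algebraMap_injective]

theorem contentIdeal_subset_zdSet_s17 (hB : IsContentAlgebra R B) {f : B} (hf : f ∈ zdSet B) :
    (contentIdeal R f : Set R) ⊆ zdSet R := by
  classical
  obtain ⟨g, hg, hfg⟩ := hf
  have hex : ∃ n, contentIdeal R f ^ n * contentIdeal R g = ⊥ := by
    obtain ⟨n, -, hn⟩ := hB.dedekind_mertens f g
    exact ⟨n, by rw [hn, hfg, contentIdeal_zero, Ideal.mul_bot]⟩
  obtain ⟨m, hm, hmin⟩ := Nat.findX hex
  cases m with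
  | zero =>
    rw [pow_zero, one_mul, hB.contentIdeal_eq_bot_iff] at hm
    exact absurd hm hg
  | succ m =>
    obtain ⟨s, hs, hs0⟩ := Submodule.exists_mem_ne_zero_of_ne_bot (hmin m m.lt_succ_self)
    refine fun r hr => ⟨s, hs0, ?_⟩
    have hrs := Ideal.mul_mem_mul hr hs
    rwa [← mul_assoc, ← pow_succ', hm, Ideal.mem_bot] at hrs

theorem zdSet_subset_span (hB : IsContentAlgebra R B) :
    zdSet B ⊆ (Ideal.span (algebraMap R B '' zdSet R) : Set B) := fun f hf =>
  Ideal.span_mono (Set.image_mono (hB.contentIdeal_subset_zdSet_s17 hf))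
    (hB.mem_map_contentIdeal f)

theorem prod_eq_zero_of_contentIdeal (hB : IsContentAlgebra R B) {ι : Type*} [Fintype ι]
    {g : ι → B}
    (h : ∀ z : ι → R, (∀ i, z i ∈ contentIdeal R (g i)) → ∏ i, z i = 0) :
    ∏ i, g i = 0 := by
  have hbot : ∏ i, contentIdeal R (g i) = ⊥ := by
    have hspan := Ideal.prod_span Finset.univ fun i => (contentIdeal R (g i) : Set R)
    simp only [Ideal.span_eq] at hspan
    rw [hspan, Ideal.span_eq_bot]
    intro x hx
    obtain ⟨z, hz, rfl⟩ := Set.mem_fintype_prod _ _ |>.mp hx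
    exact h z fun i => hz i
  have hmem : ∏ i, g i ∈ ∏ i, (contentIdeal R (g i)).map (algebraMap R B) :=
    Ideal.prod_mem_prod fun i _ => hB.mem_map_contentIdeal (g i)
  have hmap := map_prod (Ideal.mapHom (algebraMap R B)) (fun i => contentIdeal R (g i))
    Finset.univ
  simp only [Ideal.mapHom_apply] at hmap
  rwa [← hmap, hbot, Ideal.map_bot, Ideal.mem_bot] at hmem

end IsContentAlgebra

/-- Let `B` be a content `R`-algebra. Then (1) `Nil(B) = Nil(R)B`; (2)
`Z(R) ⊆ Z(B) ⊆ Z(R)B` (identifying `R` with its image in `B`); (3) for every `n ≥ 1`,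
every product of `n` elements of `Z(R)` is zero iff every product of `n` elements of
`Z(B)` is zero. -/
theorem nilradical_zdSet_of_isContentAlgebra
    (R B : Type*) [CommRing R] [CommRing B] [Algebra R B]
    (hB : IsContentAlgebra R B) :
    nilradical B = (nilradical R).map (algebraMap R B) ∧
    (algebraMap R B '' zdSet R ⊆ zdSet B ∧
      zdSet B ⊆ (Ideal.span (algebraMap R B '' zdSet R) : Set B)) ∧
    (∀ n : ℕ, 1 ≤ n →
      ((∀ z : Fin n → R, (∀ i, z i ∈ zdSet R) → ∏ i, z i = 0) ↔
        (∀ g : Fin n → B, (∀ i, g i ∈ zdSet B) → ∏ i, g i = 0))) := by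
  refine ⟨hB.nilradical_eq_map, ⟨?_, hB.zdSet_subset_span⟩, fun n _ => ⟨fun h g hg => ?_,
    fun h z hz => ?_⟩⟩
  · rintro _ ⟨r, hr, rfl⟩
    exact hB.algebraMap_mem_zdSet hr
  · exact hB.prod_eq_zero_of_contentIdeal fun z hz =>
      h z fun i => hB.contentIdeal_subset_zdSet_s17 (hg i) (hz i)
  · apply hB.algebraMap_injective
    rw [map_prod, map_zero]
    exact h _ fun i => hB.algebraMap_mem_zdSet (hz i)
end
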